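/- Let F₂ denote the free group on two generators. For every finite alphabet X, a language L ⊆ X* lies in VA(F₂) if and only if L is context-free (generated by some context-free grammar). -/

import Mathlib

namespace Paper

/-- `VA M L`: the language `L ⊆ X*` is accepted by a valence automaton over the monoid `M`,
via the standard characterization: there are a finite alphabet `Y`, a regular language
`R ⊆ Y*`, and monoid homomorphisms `φ : Y* → M`, `h : Y* → X*` with `L = h(R ∩ φ⁻¹(1))`. -/
def VA (M : Type*) [Monoid M] {X : Type} (L : Language X) : Prop :=
  ∃ (Y : Type) (_ : Fintype Y) (R : Language Y)
    (φ : FreeMonoid Y →* M) (h : FreeMonoid Y →* FreeMonoid X),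
    R.IsRegular ∧
      L = (fun w => FreeMonoid.toList (h w)) ''
            {w : FreeMonoid Y | FreeMonoid.toList w ∈ R ∧ φ w = 1}

/-! ### Embedding free groups of countable rank into the free group of rank two -/

/-- The shift action of `ℤ` on the free group on generators indexed by `ℤ`. -/
def shift : Multiplicative ℤ →* MulAut (FreeGroup ℤ) where
  toFun n := FreeGroup.freeGroupCongr (Equiv.addLeft n.toAdd)
  map_one' := by ext x; induction x using FreeGroup.induction_on <;> simp_all
  map_mul' m n := by
    ext x; induction x using FreeGroup.induction_on <;> simp_all [add_assoc]

/-- The homomorphism sending the `n`-th generator to the conjugate `aⁿ b a⁻ⁿ`. -/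
def conjHom : FreeGroup ℤ →* FreeGroup (Fin 2) :=
  FreeGroup.lift fun n => FreeGroup.of 0 ^ n * FreeGroup.of 1 * (FreeGroup.of 0 ^ n)⁻¹

theorem conjHom_injective : Function.Injective conjHom := by
  let ψ : FreeGroup (Fin 2) →* FreeGroup ℤ ⋊[shift] Multiplicative ℤ :=
    FreeGroup.lift ![SemidirectProduct.inr (Multiplicative.ofAdd 1),
      SemidirectProduct.inl (FreeGroup.of 0)]
  have key : ψ.comp conjHom = SemidirectProduct.inl := by
    ext n
    all_goals
      simp only [ψ, conjHom, MonoidHom.comp_apply, FreeGroup.lift_apply_of, map_mul, map_zpow,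
        map_inv, Matrix.cons_val_zero, Matrix.cons_val_one]
      rw [← map_zpow, ← map_inv, ← SemidirectProduct.inl_aut]
      simp [shift, ← ofAdd_zsmul]
  have h : Function.Injective (ψ ∘ conjHom) := by
    rw [← MonoidHom.coe_comp, key]
    exact SemidirectProduct.inl_injective
  exact h.of_comp

theorem exists_injective_freeGroup_fin_two (A : Type*) [Countable A] :
    ∃ f : FreeGroup A →* FreeGroup (Fin 2), Function.Injective f := by
  obtain ⟨e, he⟩ := exists_injective_nat A
  exact ⟨conjHom.comp (FreeGroup.map fun a => (e a : ℤ)),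
    conjHom_injective.comp (FreeGroup.map_injective (Nat.cast_injective.comp he))⟩

theorem VA.of_injective {M N : Type*} [Monoid M] [Monoid N] {X : Type} {L : Language X}
    (hL : VA M L) (f : M →* N) (hf : Function.Injective f) : VA N L := by
  obtain ⟨Y, hY, R, φ, h, hR, rfl⟩ := hL
  refine ⟨Y, hY, R, f.comp φ, h, hR, ?_⟩
  simp only [MonoidHom.comp_apply, map_eq_one_iff f hf]
  rfl

/-! ### Walks with labels in a free group -/

section Walk

variable {S A X : Type}

/-- Walks in a graph whose edges carry either a word over `X` (silent edges) or a letter of the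
free group over `A`. `Walk E B p u g q` says that some walk from `p` to `q` spells `u` and has
value `g`. -/
inductive Walk (E : S → A × Bool → S → Prop) (B : S → List X → S → Prop) :
    S → List X → FreeGroup A → S → Prop
  | refl (p : S) : Walk E B p [] 1 p
  | silent {p q r : S} {u v : List X} {g : FreeGroup A} :
      B p u q → Walk E B q v g r → Walk E B p (u ++ v) g r
  | op {p q r : S} {c : A × Bool} {u : List X} {g : FreeGroup A} :
      E p c q → Walk E B q u g r → Walk E B p u (FreeGroup.mk [c] * g) r

theorem Walk.mono {E : S → A × Bool → S → Prop} {B B' : S → List X → S → Prop}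
    (hB : ∀ p u q, B p u q → B' p u q) {p q : S} {u : List X} {g : FreeGroup A}
    (h : Walk E B p u g q) : Walk E B' p u g q := by
  induction h with
  | refl p => exact .refl p
  | silent hb _ ih => exact .silent (hB _ _ _ hb) ih
  | op he _ ih => exact .op he ih

theorem Walk.trans {E : S → A × Bool → S → Prop} {B : S → List X → S → Prop}
    {p q r : S} {u v : List X} {g k : FreeGroup A}
    (h : Walk E B p u g q) (h' : Walk E B q v k r) : Walk E B p (u ++ v) (g * k) r := by
  induction h with
  | refl p => simpa using h'
  | silent hb _ ih => simpa using Walk.silent hb (ih h')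
  | op he _ ih => simpa [mul_assoc] using Walk.op he (ih h')

/-- Walks presented as alternating silent edges and letters, keeping track of the letters. -/
inductive AlternatingWalk (E : S → A × Bool → S → Prop) (B : S → List X → S → Prop) :
    S → List X → List (A × Bool) → S → Prop
  | base {p q : S} {u : List X} : B p u q → AlternatingWalk E B p u [] q
  | cons {p q r s : S} {u v : List X} {c : A × Bool} {l : List (A × Bool)} :
      B p u q → E q c r → AlternatingWalk E B r v l s → AlternatingWalk E B p (u ++ v) (c :: l) s

theorem AlternatingWalk.silent {E : S → A × Bool → S → Prop} {B : S → List X → S → Prop}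
    (trans : ∀ p u q v r, B p u q → B q v r → B p (u ++ v) r)
    {p q r : S} {u v : List X} {l : List (A × Bool)} (hb : B p u q)
    (h : AlternatingWalk E B q v l r) : AlternatingWalk E B p (u ++ v) l r := by
  cases h with
  | base hb' => exact .base (trans _ _ _ _ _ hb hb')
  | cons hb' he h => simpa using AlternatingWalk.cons (trans _ _ _ _ _ hb hb') he h

/-- If silent edges can be composed and can replace every cancelling pair of letters, every walk
can be freely reduced. -/
theorem Walk.exists_isReduced {E : S → A × Bool → S → Prop} {B : S → List X → S → Prop}
    (refl : ∀ p, B p [] p)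
    (trans : ∀ p u q v r, B p u q → B q v r → B p (u ++ v) r)
    (cancel : ∀ p a b p' u q' q, E p (a, b) p' → B p' u q' → E q' (a, !b) q → B p u q)
    {p q : S} {u : List X} {g : FreeGroup A} (h : Walk E B p u g q) :
    ∃ l, FreeGroup.IsReduced l ∧ FreeGroup.mk l = g ∧ AlternatingWalk E B p u l q := by
  induction h with
  | refl p => exact ⟨[], .nil, rfl, .base (refl p)⟩
  | silent hb _ ih =>
    obtain ⟨l, hl, hg, hw⟩ := ih
    exact ⟨l, hl, hg, hw.silent trans hb⟩
  | @op p q r c u g he _ ih =>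
    obtain ⟨l, hl, rfl, hw⟩ := ih
    by_cases hred : FreeGroup.IsReduced (c :: l)
    · exact ⟨c :: l, hred, by simp, by simpa using AlternatingWalk.cons (refl p) he hw⟩
    · cases hw with
      | base => simp at hred
      | @cons _ s t _ u v d l hb he' hw =>
        obtain ⟨a, b⟩ := c
        obtain ⟨a', b'⟩ := d
        have hd : a = a' ∧ b' = !b := by
          rw [FreeGroup.isReduced_cons_cons] at hred
          cases b <;> cases b' <;> simp_all
        obtain ⟨rfl, rfl⟩ := hd
        refine ⟨l, hl.infix ⟨[(a, !b)], [], by simp⟩, ?_,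
          hw.silent trans (cancel _ _ _ _ _ _ _ he hb he')⟩
        rw [FreeGroup.mul_mk]
        exact (Quot.sound FreeGroup.Red.Step.cons_not).symm

theorem Walk.silent_of_one {E : S → A × Bool → S → Prop} {B : S → List X → S → Prop}
    (refl : ∀ p, B p [] p)
    (trans : ∀ p u q v r, B p u q → B q v r → B p (u ++ v) r)
    (cancel : ∀ p a b p' u q' q, E p (a, b) p' → B p' u q' → E q' (a, !b) q → B p u q)
    {p q : S} {u : List X} (h : Walk E B p u (1 : FreeGroup A) q) : B p u q := by
  classical
  obtain ⟨l, hl, hg, hw⟩ := h.exists_isReduced refl trans cancel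
  obtain rfl : l = [] := by
    rw [← hl.reduce_eq, ← FreeGroup.toWord_mk, hg, FreeGroup.toWord_one]
  cases hw with
  | base hb => exact hb

end Walk

/-! ### Big-step semantics of context-free grammars -/

section Grammar

variable {T : Type}

/-- Big-step derivations of terminal words in a context-free grammar. -/
inductive Yields (g : ContextFreeGrammar T) : List (Symbol T g.NT) → List T → Prop
  | nil : Yields g [] []
  | terminal (t : T) {s : List (Symbol T g.NT)} {w : List T} :
      Yields g s w → Yields g (.terminal t :: s) (t :: w)
  | nonterminal {r : ContextFreeRule T g.NT} {s : List (Symbol T g.NT)} {u w : List T} :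
      r ∈ g.rules → Yields g r.output u → Yields g s w →
        Yields g (.nonterminal r.input :: s) (u ++ w)

variable {g : ContextFreeGrammar T}

theorem Yields.append {s s' : List (Symbol T g.NT)} {u v : List T} (h : Yields g s u)
    (h' : Yields g s' v) : Yields g (s ++ s') (u ++ v) := by
  induction h with
  | nil => exact h'
  | terminal t _ ih => exact .terminal t ih
  | nonterminal hr h₁ _ _ ih => simpa using Yields.nonterminal hr h₁ ih

theorem Yields.exists_of_append {s s' : List (Symbol T g.NT)} {w : List T}
    (h : Yields g (s ++ s') w) : ∃ u v, w = u ++ v ∧ Yields g s u ∧ Yields g s' v := by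
  induction s generalizing w with
  | nil => exact ⟨[], w, rfl, .nil, h⟩
  | cons x s ih =>
    cases h with
    | terminal t h =>
      obtain ⟨u, v, rfl, hu, hv⟩ := ih h
      exact ⟨t :: u, v, rfl, .terminal t hu, hv⟩
    | @nonterminal r _ u₁ _ hr h₁ h =>
      obtain ⟨u, v, rfl, hu, hv⟩ := ih h
      exact ⟨u₁ ++ u, v, by simp, .nonterminal hr h₁ hu, hv⟩

theorem yields_map_terminal (w : List T) : Yields g (w.map .terminal) w := by
  induction w with
  | nil => exact .nil
  | cons t w ih => exact .terminal t ih

theorem Yields.of_produces {s s' : List (Symbol T g.NT)} {w : List T} (h : g.Produces s s')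
    (hw : Yields g s' w) : Yields g s w := by
  obtain ⟨r, hr, h⟩ := h
  obtain ⟨p, q, rfl, rfl⟩ := h.exists_parts
  obtain ⟨_, u₃, rfl, h₁₂, h₃⟩ := hw.exists_of_append
  obtain ⟨u₁, u₂, rfl, h₁, h₂⟩ := h₁₂.exists_of_append
  refine (h₁.append ?_).append h₃
  simpa using Yields.nonterminal hr h₂ .nil

theorem Yields.derives {s : List (Symbol T g.NT)} {w : List T} (h : Yields g s w) :
    g.Derives s (w.map .terminal) := by
  induction h with
  | nil => rfl
  | terminal t _ ih => exact ih.append_left [.terminal t]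
  | @nonterminal r s u w hr _ _ ih₁ ih₂ =>
    have h : g.Produces (.nonterminal r.input :: s) (r.output ++ s) := ⟨r, hr, .head s⟩
    simpa using h.trans_derives ((ih₁.append_right s).trans (ih₂.append_left _))

theorem yields_iff_derives {s : List (Symbol T g.NT)} {w : List T} :
    Yields g s w ↔ g.Derives s (w.map .terminal) := by
  refine ⟨Yields.derives, fun h => ?_⟩
  induction h using Relation.ReflTransGen.head_induction_on with
  | refl => exact yields_map_terminal w
  | head hp _ ih => exact ih.of_produces hp

theorem mem_language_iff_yields {w : List T} :
    w ∈ g.language ↔ Yields g [.nonterminal g.initial] w :=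
  yields_iff_derives.symm

theorem Yields.of_rule {r : ContextFreeRule T g.NT} (hr : r ∈ g.rules) {w : List T}
    (h : Yields g r.output w) : Yields g [.nonterminal r.input] w := by
  simpa using Yields.nonterminal hr h .nil

/-- The words obtained from a sentential form by replacing each nonterminal by a word in the
language assigned to it. -/
def Substitutes {N : Type} (I : N → List T → Prop) : List (Symbol T N) → List T → Prop
  | [], w => w = []
  | .terminal t :: s, w => ∃ v, w = t :: v ∧ Substitutes I s v
  | .nonterminal n :: s, w => ∃ u v, w = u ++ v ∧ I n u ∧ Substitutes I s v

theorem substitutes_map_terminal {N : Type} {I : N → List T → Prop} {u w : List T}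
    (h : Substitutes I (u.map .terminal) w) : w = u := by
  induction u generalizing w with
  | nil => exact h
  | cons t u ih =>
    obtain ⟨v, rfl, hv⟩ := h
    rw [ih hv]

theorem Yields.substitutes {I : g.NT → List T → Prop}
    (hI : ∀ r ∈ g.rules, ∀ w, Substitutes I r.output w → I r.input w)
    {s : List (Symbol T g.NT)} {w : List T} (h : Yields g s w) : Substitutes I s w := by
  induction h with
  | nil => rfl
  | terminal t _ ih => exact ⟨_, rfl, ih⟩
  | nonterminal hr _ _ ih₁ ih₂ => exact ⟨_, _, rfl, hI _ hr _ ih₁, ih₂⟩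

end Grammar

/-! ### Languages of walks of trivial value are context-free -/

section WalkGrammar

variable {S A X : Type}

/-- The rules of a grammar whose nonterminal `some (p, q)` generates the words spelled by walks of
trivial value from `p` to `q`. -/
inductive WalkRule (E : S → A × Bool → S → Prop) (B : S → List X → S → Prop) (s₀ : S) (F : Set S) :
    ContextFreeRule X (Option (S × S)) → Prop
  | start (f : S) : f ∈ F → WalkRule E B s₀ F ⟨none, [.nonterminal (some (s₀, f))]⟩
  | refl (p : S) : WalkRule E B s₀ F ⟨some (p, p), []⟩
  | trans (p q r : S) : WalkRule E B s₀ F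
      ⟨some (p, r), [.nonterminal (some (p, q)), .nonterminal (some (q, r))]⟩
  | cancel (p : S) (a : A) (b : Bool) (p' q' q : S) : E p (a, b) p' → E q' (a, !b) q →
      WalkRule E B s₀ F ⟨some (p, q), [.nonterminal (some (p', q'))]⟩
  | silent (p q : S) (u : List X) : B p u q →
      WalkRule E B s₀ F ⟨some (p, q), u.map .terminal⟩

theorem finite_walkRule [Finite S] (E : S → A × Bool → S → Prop) (B : S → List X → S → Prop)
    (s₀ : S) (F : Set S) (hB : {x : S × List X × S | B x.1 x.2.1 x.2.2}.Finite) :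
    {r | WalkRule E B s₀ F r}.Finite := by
  refine (((Set.finite_range fun f : S =>
      (⟨none, [.nonterminal (some (s₀, f))]⟩ : ContextFreeRule X (Option (S × S)))).union
    (Set.finite_range fun p : S => ⟨some (p, p), []⟩)).union
    ((Set.finite_range fun x : S × S × S => ⟨some (x.1, x.2.2),
      [.nonterminal (some (x.1, x.2.1)), .nonterminal (some (x.2.1, x.2.2))]⟩).union
    (Set.finite_range fun x : S × S × S × S => ⟨some (x.1, x.2.1),
      [.nonterminal (some (x.2.2.1, x.2.2.2))]⟩))).union
    (hB.image fun x => ⟨some (x.1, x.2.2), x.2.1.map .terminal⟩) |>.subset ?_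
  rintro _ (⟨f, _⟩ | p | ⟨p, q, r⟩ | ⟨p, a, b, p', q', q, _, _⟩ | ⟨p, q, u, h⟩)
  · exact .inl (.inl (.inl ⟨f, rfl⟩))
  · exact .inl (.inl (.inr ⟨p, rfl⟩))
  · exact .inl (.inr (.inl ⟨(p, q, r), rfl⟩))
  · exact .inl (.inr (.inr ⟨(p, q, p', q'), rfl⟩))
  · exact .inr ⟨(p, u, q), h, rfl⟩

theorem isContextFree_walk [Finite S] (E : S → A × Bool → S → Prop) (B : S → List X → S → Prop)
    (s₀ : S) (F : Set S) (hB : {x : S × List X × S | B x.1 x.2.1 x.2.2}.Finite) :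
    Language.IsContextFree {u : List X | ∃ f ∈ F, Walk E B s₀ u 1 f} := by
  let g : ContextFreeGrammar X :=
    ⟨Option (S × S), none, (finite_walkRule E B s₀ F hB).toFinset⟩
  have hg {r : ContextFreeRule X (Option (S × S))} : r ∈ g.rules ↔ WalkRule E B s₀ F r :=
    Set.Finite.mem_toFinset _
  refine ⟨g, Set.ext fun w => ?_⟩
  refine mem_language_iff_yields.trans ⟨fun h => ?_, ?_⟩
  · let I : Option (S × S) → List X → Prop
      | none, u => ∃ f ∈ F, Walk E B s₀ u 1 f
      | some (p, q), u => Walk E B p u 1 q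
    have hI : Substitutes I [.nonterminal none] w := by
      refine h.substitutes fun r hr w hw => ?_
      cases hg.1 hr with
      | start f hf =>
        obtain ⟨u, _, rfl, hu, rfl⟩ := hw
        exact ⟨f, hf, by simpa using hu⟩
      | refl p =>
        obtain rfl : w = [] := hw
        exact .refl p
      | trans p q r =>
        obtain ⟨u, _, rfl, hu, v, _, rfl, hv, rfl⟩ := hw
        simpa [I] using Walk.trans hu hv
      | cancel p a b p' q' q h₁ h₂ =>
        obtain ⟨u, _, rfl, hu, rfl⟩ := hw
        have := Walk.op h₁ (Walk.trans hu (Walk.op h₂ (.refl q)))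
        have hone : FreeGroup.mk [(a, b), (a, !b)] = 1 :=
          Quot.sound FreeGroup.Red.Step.cons_not
        simpa [I, hone] using this
      | silent p q u h =>
        rw [substitutes_map_terminal hw]
        simpa using Walk.silent h (.refl (E := E) q)
    obtain ⟨u, _, rfl, hu, rfl⟩ := hI
    simpa using hu
  · rintro ⟨f, hf, h⟩
    have key : Yields g [.nonterminal (some (s₀, f))] w := by
      refine Walk.silent_of_one (B := fun p u q => Yields g [.nonterminal (some (p, q))] u)
        (fun p => .of_rule (hg.2 (.refl p)) .nil) (fun p u q v r hu hv => ?_)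
        (fun p a b p' u q' q h₁ hu h₂ => .of_rule (hg.2 (.cancel p a b p' q' q h₁ h₂)) hu)
        (h.mono fun p u q hb => .of_rule (hg.2 (.silent p q u hb)) (yields_map_terminal u))
      exact .of_rule (hg.2 (.trans p q r)) (hu.append hv)
    exact .of_rule (hg.2 (.start f hf)) key

end WalkGrammar

/-! ### Valence automata over free groups accept context-free languages -/

theorem VA.isContextFree {A X : Type} [Finite A] {L : Language X}
    (hL : VA (FreeGroup A) L) : L.IsContextFree := by
  classical
  obtain ⟨Y, _, R, φ, h, ⟨σ, _, M, rfl⟩, rfl⟩ := hL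
  obtain ⟨n, hn⟩ := (Set.finite_range fun y : Y => (φ (.of y)).toWord.length).bddAbove
  have hword (y : Y) : (φ (.of y)).toWord.length ≤ n := hn ⟨y, rfl⟩
  let Q : Type := {l : List (A × Bool) // l.length ≤ n}
  have : Finite Q := (List.finite_length_le (A × Bool) n).to_subtype
  let E (p : σ × Q) (c : A × Bool) (q : σ × Q) : Prop := p.1 = q.1 ∧ p.2.1 = c :: q.2.1
  let B (p : σ × Q) (u : List X) (q : σ × Q) : Prop :=
    ∃ y, p.2.1 = [] ∧ u = (h (.of y)).toList ∧ q = (M.step p.1 y, ⟨(φ (.of y)).toWord, hword y⟩)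
  let ε : Q := ⟨[], by simp⟩
  have hB : {x : (σ × Q) × List X × (σ × Q) | B x.1 x.2.1 x.2.2}.Finite := by
    refine (Set.finite_range fun x : (σ × Q) × Y => (x.1, (h (.of x.2)).toList,
      (M.step x.1.1 x.2, (⟨(φ (.of x.2)).toWord, hword x.2⟩ : Q)))).subset ?_
    rintro ⟨p, u, q⟩ ⟨y, _, hu, hq⟩
    exact ⟨(p, y), by simp_all⟩
  have unload (s : σ) (q : Q) {u : List X} {k : FreeGroup A} {r : σ × Q}
      (hw : Walk E B (s, ε) u k r) : Walk E B (s, q) u (FreeGroup.mk q.1 * k) r := by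
    obtain ⟨l, hl⟩ := q
    induction l with
    | nil => simpa [FreeGroup.one_eq_mk.symm] using hw
    | cons c l ih =>
      have hl' : l.length ≤ n := (Nat.le_succ _).trans hl
      have := Walk.op (E := E) (p := (s, ⟨c :: l, hl⟩)) (q := (s, ⟨l, hl'⟩)) (c := c)
        ⟨rfl, rfl⟩ (ih hl')
      simpa [← mul_assoc] using this
  have complete (w : List Y) (s : σ) : Walk E B (s, ε) (h (.ofList w)).toList (φ (.ofList w))
      (M.evalFrom s w, ε) := by
    induction w generalizing s with
    | nil => simpa using Walk.refl (E := E) (B := B) (s, ε)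
    | cons y w ih =>
      have := Walk.silent (E := E) (B := B) (p := (s, ε)) ⟨y, rfl, rfl, rfl⟩
        (unload (M.step s y) ⟨(φ (.of y)).toWord, hword y⟩ (ih _))
      simpa [FreeMonoid.ofList_cons, FreeGroup.mk_toWord] using this
  have sound {p q : σ × Q} {u : List X} {k : FreeGroup A} (hw : Walk E B p u k q)
      (hq : q.2 = ε) : ∃ w : List Y, M.evalFrom p.1 w = q.1 ∧ (h (.ofList w)).toList = u ∧
        k = FreeGroup.mk p.2.1 * φ (.ofList w) := by
    induction hw with
    | refl p => exact ⟨[], rfl, by simp, by simp [hq, ε, FreeGroup.one_eq_mk.symm]⟩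
    | silent hb _ ih =>
      obtain ⟨y, hp, rfl, rfl⟩ := hb
      obtain ⟨w, hw, rfl, rfl⟩ := ih hq
      refine ⟨y :: w, hw, by simp [FreeMonoid.ofList_cons], ?_⟩
      simp [FreeMonoid.ofList_cons, FreeGroup.mk_toWord, hp, FreeGroup.one_eq_mk.symm]
    | op he _ ih =>
      obtain ⟨w, hw, rfl, rfl⟩ := ih hq
      exact ⟨w, he.1 ▸ hw, rfl, by simp [he.2, ← mul_assoc]⟩
  refine (congrArg Language.IsContextFree (Set.ext fun u => ?_)).mpr
    (isContextFree_walk E B (M.start, ε) {q | q.1 ∈ M.accept ∧ q.2 = ε} hB)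
  constructor
  · rintro ⟨w, ⟨hR, hφ⟩, rfl⟩
    have := complete w.toList M.start
    simp only [FreeMonoid.ofList_toList, hφ] at this
    exact ⟨(M.evalFrom M.start w.toList, ε), ⟨hR, rfl⟩, this⟩
  · rintro ⟨⟨f, _⟩, ⟨hf, rfl⟩, hw⟩
    obtain ⟨w, heval, rfl, hk⟩ := sound hw rfl
    refine ⟨.ofList w, ⟨?_, ?_⟩, rfl⟩
    · change M.evalFrom M.start w ∈ M.accept
      rwa [heval]
    · simpa [ε, FreeGroup.one_eq_mk.symm] using hk.symm

/-! ### Context-free languages are accepted by valence automata over free groups -/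

theorem isRegular_nfa_accepts {Y σ : Type} [Finite σ] (M : NFA Y σ) : M.accepts.IsRegular := by
  have := Fintype.ofFinite (Set σ)
  exact ⟨Set σ, this, M.toDFA, M.toDFA_correct⟩

section CallReturn

variable {X : Type} (g : ContextFreeGrammar X)

/-- The suffixes of the sentential forms occurring in the grammar `g`. -/
def forms : Set (List (Symbol X g.NT)) :=
  {l | l <:+ [.nonterminal g.initial] ∨ ∃ r ∈ g.rules, l <:+ r.output}

theorem finite_forms : (forms g).Finite := by
  have hs (l : List (Symbol X g.NT)) : {l' | l' <:+ l}.Finite := by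
    refine l.tails.finite_toSet.subset fun l' h => ?_
    simpa using h
  refine ((hs [.nonterminal g.initial]).union
    (g.rules.finite_toSet.biUnion fun r _ => hs r.output)).subset ?_
  rintro l (h | ⟨r, hr, h⟩)
  · exact .inl h
  · exact .inr (Set.mem_biUnion hr h)

instance : Finite (forms g) := finite_forms g

variable {g}

theorem mem_forms_of_suffix {l l' : List (Symbol X g.NT)} (h : l' <:+ l) (hl : l ∈ forms g) :
    l' ∈ forms g :=
  hl.imp h.trans fun ⟨r, hr, h'⟩ => ⟨r, hr, h.trans h'⟩

theorem output_mem_forms {r : ContextFreeRule X g.NT} (hr : r ∈ g.rules) : r.output ∈ forms g :=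
  .inr ⟨r, hr, List.suffix_refl _⟩

variable (g)

/-- The instructions of the recursive-descent automaton of `g`: a call of the second form with the
first one as return address, a return to the given form, or the output of a terminal. -/
abbrev Instruction : Type := (forms g × forms g) ⊕ forms g ⊕ X

/-- The steps of the recursive-descent automaton of `g`, whose states are the remaining parts of
the sentential forms being expanded. -/
inductive DescentStep : forms g → Instruction g → forms g → Prop
  | call (p s : forms g) (r : ContextFreeRule X g.NT) (hr : r ∈ g.rules) :
      p.1 = .nonterminal r.input :: s.1 →
      DescentStep p (.inl (s, ⟨r.output, output_mem_forms hr⟩)) ⟨r.output, output_mem_forms hr⟩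
  | ret (p s : forms g) : p.1 = [] → DescentStep p (.inr (.inl s)) s
  | out (p s : forms g) (t : X) : p.1 = .terminal t :: s.1 → DescentStep p (.inr (.inr t)) s

/-- The final state of the recursive-descent automaton. -/
def doneForm : forms g := ⟨[], .inl (List.nil_suffix)⟩

/-- The initial state of the recursive-descent automaton. -/
def initialForm : forms g := ⟨[.nonterminal g.initial], .inl (List.suffix_refl _)⟩

/-- The recursive-descent automaton of `g`. -/
def descentNFA : NFA (Instruction g) (forms g) where
  step p y := {q | DescentStep g p y q}
  start := {initialForm g}
  accept := {doneForm g}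

/-- The effect of a word of instructions on the stack of return addresses. -/
def stackHom : FreeMonoid (Instruction g) →* FreeGroup (forms g) :=
  FreeMonoid.lift fun
    | .inl (s, _) => FreeGroup.mk [(s, true)]
    | .inr (.inl s) => FreeGroup.mk [(s, false)]
    | .inr (.inr _) => 1

/-- The output of a word of instructions. -/
def outputHom : FreeMonoid (Instruction g) →* FreeMonoid X :=
  FreeMonoid.lift fun
    | .inl _ => 1
    | .inr (.inl _) => 1
    | .inr (.inr t) => .of t

variable {g}

theorem Yields.exists_mem_evalFrom {l : List (Symbol X g.NT)} {u : List X} (h : Yields g l u)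
    (hl : l ∈ forms g) : ∃ w, doneForm g ∈ (descentNFA g).evalFrom {⟨l, hl⟩} w ∧
      stackHom g (.ofList w) = 1 ∧ (outputHom g (.ofList w)).toList = u := by
  induction h with
  | nil => exact ⟨[], rfl, by simp, by simp⟩
  | @terminal t s w _ ih =>
    have hs := mem_forms_of_suffix (List.suffix_cons _ _) hl
    obtain ⟨w, h₁, h₂, h₃⟩ := ih hs
    refine ⟨.inr (.inr t) :: w, ?_, ?_, ?_⟩
    · rw [NFA.evalFrom_cons, NFA.stepSet_singleton, NFA.mem_evalFrom_iff_exists]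
      exact ⟨⟨s, hs⟩, DescentStep.out _ _ t rfl, h₁⟩
    · simpa [FreeMonoid.ofList_cons, stackHom] using h₂
    · simpa [FreeMonoid.ofList_cons, outputHom] using h₃
  | @nonterminal r s u v hr _ _ ih₁ ih₂ =>
    have hs := mem_forms_of_suffix (List.suffix_cons _ _) hl
    obtain ⟨w, h₁, h₂, h₃⟩ := ih₁ (output_mem_forms hr)
    obtain ⟨w', h₁', h₂', h₃'⟩ := ih₂ hs
    refine ⟨.inl (⟨s, hs⟩, ⟨r.output, output_mem_forms hr⟩) ::
      (w ++ .inr (.inl ⟨s, hs⟩) :: w'), ?_, ?_, ?_⟩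
    · rw [NFA.evalFrom_cons, NFA.stepSet_singleton, NFA.mem_evalFrom_iff_exists]
      refine ⟨_, DescentStep.call _ _ r hr rfl, ?_⟩
      rw [NFA.evalFrom_append, NFA.mem_evalFrom_iff_exists]
      refine ⟨_, h₁, ?_⟩
      rw [NFA.evalFrom_cons, NFA.stepSet_singleton, NFA.mem_evalFrom_iff_exists]
      exact ⟨_, DescentStep.ret _ _ rfl, h₁'⟩
    · have hone : FreeGroup.mk [((⟨s, hs⟩ : forms g), true), (⟨s, hs⟩, false)] = 1 :=
        Quot.sound FreeGroup.Red.Step.cons_not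
      simp only [FreeMonoid.ofList_cons, FreeMonoid.ofList_append, map_mul, h₂, h₂', one_mul,
        mul_one]
      simpa [stackHom] using hone
    · simp only [FreeMonoid.ofList_cons, FreeMonoid.ofList_append, map_mul,
        FreeMonoid.toList_mul, h₃, h₃']
      simp [outputHom]

/-- The effect of calls and returns of the recursive-descent automaton. -/
def StackEdge (p : forms g) (c : forms g × Bool) (q : forms g) : Prop :=
  (c.2 = true ∧ ∃ r ∈ g.rules, p.1 = .nonterminal r.input :: c.1.1 ∧ q.1 = r.output) ∨
    (c.2 = false ∧ p.1 = [] ∧ q = c.1)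

/-- `Expands p u q` says that `q` remains from `p` after expanding a prefix to `u`. -/
def Expands (p : forms g) (u : List X) (q : forms g) : Prop :=
  ∃ l, p.1 = l ++ q.1 ∧ Yields g l u

theorem walk_of_mem_evalFrom {p q : forms g} {w : List (Instruction g)}
    (h : q ∈ (descentNFA g).evalFrom {p} w) :
    Walk StackEdge Expands p (outputHom g (.ofList w)).toList (stackHom g (.ofList w)) q := by
  induction w generalizing p with
  | nil =>
    obtain rfl : q = p := h
    simpa using Walk.refl q
  | cons y w ih =>
    rw [NFA.evalFrom_cons, NFA.stepSet_singleton, NFA.mem_evalFrom_iff_exists] at h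
    obtain ⟨p', hstep, h⟩ := h
    have hw := ih h
    rw [FreeMonoid.ofList_cons, map_mul (outputHom g), map_mul (stackHom g), FreeMonoid.toList_mul]
    cases hstep with
    | call s r hr hp => exact .op (.inl ⟨rfl, r, hr, hp, rfl⟩) hw
    | ret _ hp => exact .op (.inr ⟨rfl, hp, rfl⟩) hw
    | out _ t hp =>
      have := Walk.silent (E := StackEdge) (p := p) (u := [t])
        ⟨[.terminal t], hp, .terminal t .nil⟩ hw
      simpa [stackHom, outputHom] using this

theorem expands_of_walk_one {p q : forms g} {u : List X}
    (h : Walk StackEdge Expands p u 1 q) : Expands p u q := by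
  refine h.silent_of_one (fun p => ⟨[], rfl, .nil⟩) ?_ ?_
  · rintro p u q v r ⟨l, hp, hl⟩ ⟨l', hq, hl'⟩
    exact ⟨l ++ l', by simp [hp, hq], hl.append hl'⟩
  · rintro p a b p' u q' q h₁ ⟨l, hp', hl⟩ h₂
    obtain ⟨rfl, r, hr, hp, hr'⟩ | ⟨rfl, _, rfl⟩ := h₁
    · obtain ⟨h, _⟩ | ⟨_, hq', rfl⟩ := h₂
      · simp at h
      · obtain rfl : r.output = l := by simpa [hr', hq'] using hp'
        exact ⟨[.nonterminal r.input], hp, .of_rule hr hl⟩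
    · obtain ⟨_, r, hr, hq', _⟩ | ⟨h, _⟩ := h₂
      · have := congrArg List.length hp'
        simp [hq'] at this
        omega
      · simp at h

theorem va_language_forms (g : ContextFreeGrammar X) [Fintype X] :
    VA (FreeGroup (forms g)) g.language := by
  have := Fintype.ofFinite (forms g)
  refine ⟨Instruction g, inferInstance, (descentNFA g).accepts, stackHom g, outputHom g,
    isRegular_nfa_accepts _, Set.ext fun u => ?_⟩
  refine mem_language_iff_yields.trans ⟨fun h => ?_, ?_⟩
  · obtain ⟨w, h₁, h₂, h₃⟩ := h.exists_mem_evalFrom (initialForm g).2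
    exact ⟨.ofList w, ⟨NFA.mem_accepts.2 ⟨_, rfl, h₁⟩, h₂⟩, h₃⟩
  · rintro ⟨w, ⟨hw, hφ⟩, rfl⟩
    obtain ⟨_, rfl, hw⟩ := NFA.mem_accepts.1 hw
    have := walk_of_mem_evalFrom hw
    rw [FreeMonoid.ofList_toList, hφ] at this
    obtain ⟨l, hl, h⟩ := expands_of_walk_one this
    obtain rfl : [.nonterminal g.initial] = l := by simpa [initialForm, doneForm] using hl
    exact h

end CallReturn

/-- For the free group `F₂` on two generators, `VA F₂` is exactly the
class of context-free languages. -/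
theorem stmt6 (X : Type) [Fintype X] (L : Language X) :
    VA (FreeGroup (Fin 2)) L ↔ L.IsContextFree := by
  refine ⟨VA.isContextFree, ?_⟩
  rintro ⟨g, rfl⟩
  obtain ⟨f, hf⟩ := exists_injective_freeGroup_fin_two (forms g)
  exact (va_language_forms g).of_injective f hf

end Paper
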